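/- Unique continuation for the fractional Laplacian: let n ≥ 1, a ∈ (0,1), let u : ℝⁿ → ℝ be a Schwartz function, and let Σ ⊆ ℝⁿ be a nonempty open set. Suppose that u(x) = 0 for every x ∈ Σ, and that for every x ∈ Σ the (absolutely convergent) integral ∫_{ℝⁿ} u(y) |x − y|^{-(n+2a)} dy equals 0. Then u is identically zero on ℝⁿ. -/

import Mathlib

open MeasureTheory Set

section UniqueContinuation

variable {E : Type*} [NormedAddCommGroup E] [InnerProductSpace ℝ E]

/-- A continuous function whose Laplace transform vanishes near the origin along every direction,
with all exponential moments finite, is zero. -/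
lemma eq_zero_of_integral_mul_exp_inner_eq_zero [MeasurableSpace E] [BorelSpace E]
    [SecondCountableTopology E] [CompleteSpace E] (μ : Measure E) [μ.IsOpenPosMeasure]
    {g : E → ℝ} (hg : Continuous g)
    (hint : ∀ (v : E) (t : ℝ), Integrable (fun y ↦ g y * Real.exp (t * inner ℝ y v)) μ)
    (hzero : ∀ v : E, ∀ᶠ t : ℝ in nhds 0, ∫ y, g y * Real.exp (t * inner ℝ y v) ∂μ = 0) :
    g = 0 := by
  have hgint : Integrable g μ := by simpa using hint 0 0
  have hmp : AEMeasurable (fun y ↦ ENNReal.ofReal (g y)) μ :=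
    hg.measurable.ennreal_ofReal.aemeasurable
  have hmn : AEMeasurable (fun y ↦ ENNReal.ofReal (-g y)) μ :=
    hg.measurable.neg.ennreal_ofReal.aemeasurable
  set P := μ.withDensity (fun y ↦ ENNReal.ofReal (g y)) with hP
  set N := μ.withDensity (fun y ↦ ENNReal.ofReal (-g y)) with hN
  have : IsFiniteMeasure P := isFiniteMeasure_withDensity_ofReal hgint.2
  have : IsFiniteMeasure N := isFiniteMeasure_withDensity_ofReal hgint.neg.2
  have hXm : ∀ (v : E) (t : ℝ), AEStronglyMeasurable (fun y ↦ Real.exp (t * inner ℝ y v)) μ :=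
    fun v t ↦ (by fun_prop : Continuous fun y ↦ Real.exp (t * inner ℝ y v)).aestronglyMeasurable
  have hip : ∀ (v : E) (t : ℝ),
      Integrable (fun y ↦ max (g y) 0 * Real.exp (t * inner ℝ y v)) μ := by
    intro v t
    refine (hint v t).mono ((hg.max continuous_const).aestronglyMeasurable.mul (hXm v t))
      (ae_of_all _ fun y ↦ ?_)
    rw [norm_mul, norm_mul]
    gcongr
    rw [Real.norm_eq_abs, Real.norm_eq_abs, abs_of_nonneg (le_max_right _ _)]
    exact max_le (le_abs_self _) (abs_nonneg _)
  have hin : ∀ (v : E) (t : ℝ),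
      Integrable (fun y ↦ max (-g y) 0 * Real.exp (t * inner ℝ y v)) μ := by
    intro v t
    refine (hint v t).mono ((hg.neg.max continuous_const).aestronglyMeasurable.mul (hXm v t))
      (ae_of_all _ fun y ↦ ?_)
    rw [norm_mul, norm_mul]
    gcongr
    rw [Real.norm_eq_abs, Real.norm_eq_abs, abs_of_nonneg (le_max_right _ _)]
    exact max_le (neg_le_abs _) (abs_nonneg _)
  have hSP : ∀ v : E, ProbabilityTheory.integrableExpSet (fun y ↦ inner ℝ y v) P = univ := by
    intro v
    refine eq_univ_of_forall fun t ↦ ?_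
    change Integrable _ P
    rw [hP, integrable_withDensity_iff_integrable_smul₀' hmp (by simp)]
    simpa only [ENNReal.toReal_ofReal', smul_eq_mul] using hip v t
  have hSN : ∀ v : E, ProbabilityTheory.integrableExpSet (fun y ↦ inner ℝ y v) N = univ := by
    intro v
    refine eq_univ_of_forall fun t ↦ ?_
    change Integrable _ N
    rw [hN, integrable_withDensity_iff_integrable_smul₀' hmn (by simp)]
    simpa only [ENNReal.toReal_ofReal', smul_eq_mul] using hin v t
  have hmgf : ∀ v : E, ∀ᶠ t : ℝ in nhds 0,
      ProbabilityTheory.mgf (fun y ↦ inner ℝ y v) P t =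
        ProbabilityTheory.mgf (fun y ↦ inner ℝ y v) N t := by
    intro v
    filter_upwards [hzero v] with t ht
    rw [ProbabilityTheory.mgf, ProbabilityTheory.mgf, hP, hN,
      integral_withDensity_eq_integral_toReal_smul₀ hmp (by simp),
      integral_withDensity_eq_integral_toReal_smul₀ hmn (by simp), ← sub_eq_zero]
    simp only [ENNReal.toReal_ofReal', smul_eq_mul]
    rw [← integral_sub (hip v t) (hin v t)]
    refine (integral_congr_ae (ae_of_all _ fun y ↦ ?_)).trans ht
    rw [← sub_mul]
    congr 1
    rcases le_total 0 (g y) with h | h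
    · rw [max_eq_left h, max_eq_right (by linarith)]; ring
    · rw [max_eq_right h, max_eq_left (by linarith)]; ring
  have hPN : P = N := by
    refine Measure.ext_of_charFun (funext fun v ↦ ?_)
    have hkey : ProbabilityTheory.complexMGF (fun y ↦ inner ℝ y v) P =
        ProbabilityTheory.complexMGF (fun y ↦ inner ℝ y v) N := by
      have h1 := ProbabilityTheory.analyticOnNhd_complexMGF
        (X := fun y : E ↦ (inner ℝ y v : ℝ)) (μ := P)
      have h2 := ProbabilityTheory.analyticOnNhd_complexMGF
        (X := fun y : E ↦ (inner ℝ y v : ℝ)) (μ := N)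
      rw [hSP, interior_univ] at h1
      rw [hSN, interior_univ] at h2
      refine AnalyticOnNhd.eq_of_frequently_eq (z₀ := 0) (by simpa using h1) (by simpa using h2) ?_
      have ht : Filter.Tendsto (fun t : ℝ ↦ (t : ℂ)) (nhdsWithin 0 {0}ᶜ)
          (nhdsWithin 0 {0}ᶜ) := by
        refine tendsto_nhdsWithin_of_tendsto_nhds_of_eventually_within _
          ((Complex.continuous_ofReal.tendsto' 0 0 Complex.ofReal_zero).mono_left
            nhdsWithin_le_nhds) ?_
        filter_upwards [self_mem_nhdsWithin] with t ht
        simpa using ht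
      refine ht.frequently (Filter.Eventually.frequently ?_)
      filter_upwards [(hmgf v).filter_mono nhdsWithin_le_nhds] with t h
      rw [ProbabilityTheory.complexMGF_ofReal, ProbabilityTheory.complexMGF_ofReal, h]
    have := congrFun hkey Complex.I
    simpa only [ProbabilityTheory.complexMGF, charFun_apply, mul_comm] using this
  rw [hP, hN, withDensity_eq_iff hmp hmn
    (by simpa using hgint.lintegral_lt_top.ne)] at hPN
  refine (Continuous.ae_eq_iff_eq μ hg continuous_zero).1 ?_
  filter_upwards [hPN] with y hy
  by_contra h
  rcases lt_or_gt_of_ne h with h | h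
  · rw [ENNReal.ofReal_of_nonpos (le_of_lt h)] at hy
    exact absurd hy.symm (by simpa using h)
  · rw [ENNReal.ofReal_of_nonpos (p := -g y) (by simpa using le_of_lt h)] at hy
    exact absurd hy (by simpa using h)

/-- A product `u * K` is integrable when `u` is and `K` is bounded on the support of `u`. -/
lemma integrable_mul_of_bounded_on_support {α : Type*} [MeasurableSpace α] {μ : Measure α}
    {u K : α → ℝ} (hu : Integrable u μ) (hK : AEStronglyMeasurable K μ) {C : ℝ}
    (hC : ∀ y, u y ≠ 0 → |K y| ≤ C) : Integrable (fun y ↦ u y * K y) μ := by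
  refine (hu.mul_const C).mono (hu.1.mul hK) (ae_of_all _ fun y ↦ ?_)
  by_cases h : u y = 0
  · simp [h]
  · rw [norm_mul, norm_mul]
    gcongr
    exact (hC y h).trans (le_abs_self C)

/-- A continuous integrable function whose Gaussian averages of unit width vanish on a nonempty
open set is zero. -/
lemma eq_zero_of_integral_mul_exp_neg_norm_sq_eq_zero [MeasurableSpace E] [BorelSpace E]
    [SecondCountableTopology E] [CompleteSpace E] (μ : Measure E) [μ.IsOpenPosMeasure]
    {f : E → ℝ} (hf : Continuous f) (hfi : Integrable f μ) {S : Set E} (hS : IsOpen S) {x₀ : E}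
    (hx₀ : x₀ ∈ S) (h : ∀ x ∈ S, ∫ y, f y * Real.exp (-‖x - y‖ ^ 2) ∂μ = 0) : f = 0 := by
  have key : ∀ (v y : E) (t : ℝ),
      f y * Real.exp (-‖x₀ - y‖ ^ 2) * Real.exp (t * inner ℝ y v) =
        f y * Real.exp (-‖x₀ + (t / 2) • v - y‖ ^ 2) *
          Real.exp (t * inner ℝ x₀ v + (t / 2) ^ 2 * ‖v‖ ^ 2) := by
    intro v y t
    rw [mul_assoc, mul_assoc, ← Real.exp_add, ← Real.exp_add]
    congr 2
    rw [add_sub_right_comm, norm_add_sq_real, inner_smul_right, norm_smul, mul_pow, inner_sub_left,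
      Real.norm_eq_abs, sq_abs]
    ring
  have hg : (fun y ↦ f y * Real.exp (-‖x₀ - y‖ ^ 2)) = 0 := by
    refine eq_zero_of_integral_mul_exp_inner_eq_zero μ (by fun_prop) (fun v t ↦ ?_) fun v ↦ ?_
    · simp only [key]
      refine Integrable.mul_const (integrable_mul_of_bounded_on_support (C := 1) hfi
        (by fun_prop : Continuous _).aestronglyMeasurable fun y _ ↦ ?_) _
      rw [Real.abs_exp, Real.exp_le_one_iff]
      simp
    · have hc : Filter.Tendsto (fun t : ℝ ↦ x₀ + (t / 2) • v) (nhds 0) (nhds x₀) := by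
        have : Continuous fun t : ℝ ↦ x₀ + (t / 2) • v := by fun_prop
        simpa using this.tendsto 0
      filter_upwards [hc (hS.mem_nhds hx₀)] with t ht
      simp only [key]
      rw [integral_mul_const, h _ ht, zero_mul]
  funext y
  simpa [Real.exp_ne_zero] using congrFun hg y

/-- If the Riesz-type potentials of `u` with exponents `s + 2k` all vanish at a point `x` away from
the support of `u`, then so does the Gaussian average of `u` about `x`. -/
lemma integral_mul_exp_neg_norm_sq_eq_zero {F : Type*} [NormedAddCommGroup F] [MeasurableSpace F]
    [BorelSpace F] [SecondCountableTopology F] (μ : Measure F)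
    {u : F → ℝ} (hu : Integrable u μ) {x : F} {r : ℝ} (hr : 0 < r)
    (hx : ∀ y, u y ≠ 0 → r ≤ ‖x - y‖) {s : ℝ} (hs : 0 < s)
    (h : ∀ k : ℕ, ∫ y, u y * ‖x - y‖ ^ (-(s + 2 * k)) ∂μ = 0) :
    ∫ y, u y * Real.exp (-‖x - y‖ ^ 2) ∂μ = 0 := by
  set ψ : ℝ → ℝ := fun t ↦ t ^ (-(s / 2)) * Real.exp (-t⁻¹) with hψ
  have hψ0 : ψ 0 = 0 := by
    simp [hψ, Real.zero_rpow (by linarith : -(s / 2) ≠ 0)]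
  have hψc : ContinuousOn ψ (Icc 0 ((r ^ 2)⁻¹)) := by
    intro t ht
    rcases ht.1.eq_or_lt with h0 | h0
    · subst h0
      have h1 : Filter.Tendsto ψ (nhdsWithin 0 (Ioi 0)) (nhds 0) := by
        refine ((tendsto_rpow_mul_exp_neg_mul_atTop_nhds_zero (s / 2) 1 one_pos).comp
          tendsto_inv_nhdsGT_zero).congr' ?_
        filter_upwards [self_mem_nhdsWithin] with t ht
        have ht : 0 < t := ht
        simp [hψ, Real.inv_rpow ht.le, Real.rpow_neg ht.le]
      have h2 : ContinuousWithinAt ψ (Ioi 0) 0 := by rwa [ContinuousWithinAt, hψ0]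
      refine (continuousWithinAt_insert_self.2 h2).mono fun z hz ↦ ?_
      rcases hz.1.eq_or_lt with h | h
      · exact Or.inl h.symm
      · exact Or.inr h
    · refine ContinuousAt.continuousWithinAt ?_
      exact (Real.continuousAt_rpow_const _ _ (Or.inl h0.ne')).mul
        ((continuousAt_inv₀ h0.ne').neg.rexp)
  have hpos : ∀ y, u y ≠ 0 → 0 < ‖x - y‖ := fun y hy ↦ hr.trans_le (hx y hy)
  have hpow : ∀ p : ℝ, p ≤ 0 → ∀ y, u y ≠ 0 → |‖x - y‖ ^ p| ≤ r ^ p := by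
    intro p hp y hy
    rw [abs_of_nonneg (by positivity)]
    exact Real.rpow_le_rpow_of_nonpos hr (hx y hy) hp
  have hint : ∀ p : ℝ, p ≤ 0 → Integrable (fun y ↦ u y * ‖x - y‖ ^ p) μ := fun p hp ↦
    integrable_mul_of_bounded_on_support hu (by fun_prop : Measurable _).aestronglyMeasurable
      (hpow p hp)
  have hexp : Integrable (fun y ↦ u y * Real.exp (-‖x - y‖ ^ 2)) μ := by
    refine integrable_mul_of_bounded_on_support (C := 1) hu
      (by fun_prop : Continuous _).aestronglyMeasurable fun y _ ↦ ?_
    rw [Real.abs_exp, Real.exp_le_one_iff]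
    simp
  have hbound : ∀ ε : ℝ, 0 < ε →
      |∫ y, u y * Real.exp (-‖x - y‖ ^ 2) ∂μ| ≤ ε * (r ^ (-s) * ∫ y, |u y| ∂μ) := by
    intro ε hε
    obtain ⟨p, hp⟩ := exists_polynomial_near_of_continuousOn 0 _ ψ hψc ε hε
    have hterm : ∀ y, u y * (‖x - y‖ ^ (-s) * p.eval (‖x - y‖ ^ 2)⁻¹) =
        ∑ k ∈ Finset.range (p.natDegree + 1),
          p.coeff k * (u y * ‖x - y‖ ^ (-(s + 2 * (k : ℝ)))) := by
      intro y
      by_cases hy : u y = 0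
      · simp [hy]
      rw [Polynomial.eval_eq_sum_range, Finset.mul_sum, Finset.mul_sum]
      refine Finset.sum_congr rfl fun k _ ↦ ?_
      rw [neg_add, Real.rpow_add (hpos y hy), Real.rpow_neg (hpos y hy).le (2 * (k : ℝ)),
        Real.rpow_mul (hpos y hy).le]
      norm_cast
      rw [inv_pow]
      ring
    have hsum : Integrable (fun y ↦ u y * (‖x - y‖ ^ (-s) * p.eval (‖x - y‖ ^ 2)⁻¹)) μ := by
      simp only [hterm]
      exact integrable_finsetSum _ fun k _ ↦ (hint _ (by
        have : (0 : ℝ) ≤ k := k.cast_nonneg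
        linarith)).const_mul _
    have hsum0 : ∫ y, u y * (‖x - y‖ ^ (-s) * p.eval (‖x - y‖ ^ 2)⁻¹) ∂μ = 0 := by
      simp only [hterm]
      rw [integral_finsetSum _ fun k _ ↦ (hint _ (by
        have : (0 : ℝ) ≤ k := k.cast_nonneg
        linarith)).const_mul _]
      exact Finset.sum_eq_zero fun k _ ↦ by rw [integral_const_mul, h, mul_zero]
    rw [← sub_zero (∫ y, u y * Real.exp (-‖x - y‖ ^ 2) ∂μ), ← hsum0, ← integral_sub hexp hsum,
      ← mul_assoc, ← integral_const_mul, ← Real.norm_eq_abs]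
    refine norm_integral_le_of_norm_le (hu.abs.const_mul _) (ae_of_all _ fun y ↦ ?_)
    by_cases hy : u y = 0
    · simp [hy]
    have hmem : (‖x - y‖ ^ 2)⁻¹ ∈ Icc 0 ((r ^ 2)⁻¹) := by
      refine ⟨by positivity, ?_⟩
      have := hx y hy
      gcongr
    have hψy : Real.exp (-‖x - y‖ ^ 2) = ‖x - y‖ ^ (-s) * ψ (‖x - y‖ ^ 2)⁻¹ := by
      have h1 : ((‖x - y‖ ^ 2)⁻¹) ^ (-(s / 2)) = ‖x - y‖ ^ s := by
        rw [Real.inv_rpow (by positivity), Real.rpow_neg (by positivity), inv_inv,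
          ← Real.rpow_natCast, ← Real.rpow_mul (by positivity)]
        congr 1
        push_cast
        ring
      simp only [hψ, h1, inv_inv]
      rw [← mul_assoc, ← Real.rpow_add (hpos y hy)]
      simp
    rw [hψy, ← mul_sub, ← mul_sub, norm_mul, norm_mul, Real.norm_eq_abs, Real.norm_eq_abs,
      Real.norm_eq_abs, abs_sub_comm]
    have h1 := (hp _ hmem).le
    have h2 := hpow (-s) (by linarith) y hy
    calc |u y| * (|‖x - y‖ ^ (-s)| * |p.eval (‖x - y‖ ^ 2)⁻¹ - ψ (‖x - y‖ ^ 2)⁻¹|)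
        ≤ |u y| * (r ^ (-s) * ε) := by gcongr
      _ = ε * r ^ (-s) * |u y| := by ring
  refine abs_nonpos_iff.1 (le_of_forall_pos_le_add fun δ hδ ↦ ?_)
  set A := r ^ (-s) * ∫ y, |u y| ∂μ
  have hA : 0 ≤ A := mul_nonneg (by positivity) (integral_nonneg fun y ↦ abs_nonneg _)
  refine (hbound (δ / (A + 1)) (by positivity)).trans ?_
  rw [zero_add, div_mul_eq_mul_div, div_le_iff₀ (by positivity)]
  nlinarith

/-- Differentiation under the integral sign, for a kernel controlled on the support of `u`. -/
lemma hasDerivAt_integral_mul_of_bounded_on_support {α : Type*} [MeasurableSpace α] {μ : Measure α}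
    {u : α → ℝ} (hu : Integrable u μ) {K K' : ℝ → α → ℝ} {r C C' : ℝ}
    (hK : ∀ t, AEStronglyMeasurable (K t) μ) (hK' : ∀ t, AEStronglyMeasurable (K' t) μ)
    (hC : ∀ t, |t| < r → ∀ y, u y ≠ 0 → |K t y| ≤ C)
    (hC' : ∀ t, |t| < r → ∀ y, u y ≠ 0 → |K' t y| ≤ C')
    (hd : ∀ t, |t| < r → ∀ y, u y ≠ 0 → HasDerivAt (fun τ ↦ K τ y) (K' t y) t)
    {t : ℝ} (ht : |t| < r) :
    HasDerivAt (fun τ ↦ ∫ y, u y * K τ y ∂μ) (∫ y, u y * K' t y ∂μ) t := by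
  have hopen : {τ : ℝ | |τ| < r} ∈ nhds t :=
    (isOpen_lt continuous_abs continuous_const).mem_nhds ht
  refine (hasDerivAt_integral_of_dominated_loc_of_deriv_le (bound := fun y ↦ |u y| * C')
    (F := fun τ y ↦ u y * K τ y) (F' := fun τ y ↦ u y * K' τ y) hopen
    (Filter.Eventually.of_forall fun τ ↦ hu.1.mul (hK τ))
    (integrable_mul_of_bounded_on_support hu (hK t) (hC t ht)) (hu.1.mul (hK' t))
    (ae_of_all _ fun y τ hτ ↦ ?_) (hu.abs.mul_const C') (ae_of_all _ fun y τ hτ ↦ ?_)).2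
  · by_cases hy : u y = 0
    · simp [hy]
    · rw [norm_mul]
      exact mul_le_mul_of_nonneg_left (hC' τ hτ y hy) (norm_nonneg _)
  · by_cases hy : u y = 0
    · simpa [hy] using hasDerivAt_const τ (0 : ℝ)
    · exact (hd τ hτ y hy).const_mul _

lemma hasDerivAt_norm_add_smul_rpow {w e : E} {t : ℝ} (p : ℝ) (h : w + t • e ≠ 0) :
    HasDerivAt (fun τ : ℝ ↦ ‖w + τ • e‖ ^ p)
      (p * inner ℝ (w + t • e) e * ‖w + t • e‖ ^ (p - 2)) t := by
  have h1 : HasDerivAt (fun τ : ℝ ↦ w + τ • e) e t := by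
    simpa using ((hasDerivAt_id t).smul_const e).const_add w
  have hpos : 0 < ‖w + t • e‖ := norm_pos_iff.2 h
  have h2 := h1.norm_sq.rpow_const (p := p / 2) (Or.inl (by positivity))
  have h3 : ∀ (z : E) (q : ℝ), (‖z‖ ^ 2) ^ q = ‖z‖ ^ (2 * q) := fun z q ↦ by
    rw [Real.rpow_mul (norm_nonneg _)]; norm_cast
  simp only [h3] at h2
  convert h2 using 1
  · ext τ; congr 1; ring
  · rw [show 2 * (p / 2 - 1) = p - 2 by ring]; ring

/-- If the potential of `u` with kernel `‖x - y‖ ^ (-s)` vanishes on an open set `S` on which `u`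
vanishes, then the second directional derivatives of the potential, computed under the integral
sign, converge absolutely and vanish on `S` as well. -/
lemma integral_mul_second_deriv_norm_rpow_eq_zero [MeasurableSpace E] [BorelSpace E]
    [SecondCountableTopology E] (μ : Measure E)
    {u : E → ℝ} (hu : Integrable u μ) {S : Set E} (hS : IsOpen S) (huS : ∀ x ∈ S, u x = 0)
    {s : ℝ} (hs : 0 < s) (h : ∀ x ∈ S, ∫ y, u y * ‖x - y‖ ^ (-s) ∂μ = 0)
    {x : E} (hx : x ∈ S) {e : E} (he : ‖e‖ = 1) :
    Integrable (fun y ↦ u y * (s * (s + 2) * inner ℝ (x - y) e ^ 2 * ‖x - y‖ ^ (-s - 4)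
      - s * ‖x - y‖ ^ (-s - 2))) μ ∧
    ∫ y, u y * (s * (s + 2) * inner ℝ (x - y) e ^ 2 * ‖x - y‖ ^ (-s - 4)
      - s * ‖x - y‖ ^ (-s - 2)) ∂μ = 0 := by
  obtain ⟨ρ, hρ, hball⟩ := Metric.isOpen_iff.1 hS x hx
  set r := ρ / 2 with hr_def
  have hr : 0 < r := by positivity
  have hmem : ∀ t : ℝ, |t| < r → x + t • e ∈ S := fun t ht ↦ hball <| by
    rw [Metric.mem_ball, dist_self_add_left, norm_smul, he, mul_one, Real.norm_eq_abs]
    linarith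
  have hfar : ∀ t : ℝ, |t| < r → ∀ y, u y ≠ 0 → r ≤ ‖x - y + t • e‖ := by
    intro t ht y hy
    have h1 : ρ ≤ ‖x - y‖ := by
      by_contra hc
      exact hy (huS y (hball (by rw [Metric.mem_ball, dist_comm, dist_eq_norm]; linarith)))
    have h2 := norm_sub_le_norm_add (x - y) (t • e)
    rw [norm_smul, he, mul_one, Real.norm_eq_abs] at h2
    linarith
  have hinner : ∀ w : E, |inner ℝ w e| ≤ ‖w‖ := fun w ↦ by
    simpa [he] using abs_real_inner_le_norm w e
  have hpow : ∀ p : ℝ, p ≤ 0 → ∀ t : ℝ, |t| < r → ∀ y, u y ≠ 0 →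
      ‖x - y + t • e‖ ^ p ≤ r ^ p := fun p hp t ht y hy ↦
    Real.rpow_le_rpow_of_nonpos hr (hfar t ht y hy) hp
  set K0 : ℝ → E → ℝ := fun t y ↦ ‖x - y + t • e‖ ^ (-s) with hK0
  set K1 : ℝ → E → ℝ := fun t y ↦
    -s * inner ℝ (x - y + t • e) e * ‖x - y + t • e‖ ^ (-s - 2) with hK1
  set K2 : ℝ → E → ℝ := fun t y ↦
    s * (s + 2) * inner ℝ (x - y + t • e) e ^ 2 * ‖x - y + t • e‖ ^ (-s - 4)
      - s * ‖x - y + t • e‖ ^ (-s - 2) with hK2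
  have hm0 : ∀ t, AEStronglyMeasurable (K0 t) μ := fun t ↦
    (by fun_prop : Measurable (K0 t)).aestronglyMeasurable
  have hm1 : ∀ t, AEStronglyMeasurable (K1 t) μ := fun t ↦
    (by fun_prop : Measurable (K1 t)).aestronglyMeasurable
  have hm2 : ∀ t, AEStronglyMeasurable (K2 t) μ := fun t ↦
    (by fun_prop : Measurable (K2 t)).aestronglyMeasurable
  have hb0 : ∀ t, |t| < r → ∀ y, u y ≠ 0 → |K0 t y| ≤ r ^ (-s) := fun t ht y hy ↦ by
    rw [hK0, abs_of_nonneg (by positivity)]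
    exact hpow _ (by linarith) t ht y hy
  have hb1 : ∀ t, |t| < r → ∀ y, u y ≠ 0 → |K1 t y| ≤ s * r ^ (-s - 1) := fun t ht y hy ↦ by
    have hw : 0 < ‖x - y + t • e‖ := hr.trans_le (hfar t ht y hy)
    have h1 := hinner (x - y + t • e)
    calc |K1 t y| = s * |inner ℝ (x - y + t • e) e| * ‖x - y + t • e‖ ^ (-s - 2) := by
          rw [hK1, abs_mul, abs_mul, abs_neg, abs_of_pos hs,
            abs_of_nonneg (Real.rpow_nonneg (norm_nonneg _) _)]
      _ ≤ s * ‖x - y + t • e‖ * ‖x - y + t • e‖ ^ (-s - 2) := by gcongr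
      _ = s * ‖x - y + t • e‖ ^ (-s - 1) := by
          rw [mul_assoc, ← Real.rpow_one_add' hw.le
            (by linarith : (1 : ℝ) + (-s - 2) < 0).ne]
          congr 2; ring
      _ ≤ s * r ^ (-s - 1) :=
          mul_le_mul_of_nonneg_left (hpow (-s - 1) (by linarith) t ht y hy) hs.le
  have hb2 : ∀ t, |t| < r → ∀ y, u y ≠ 0 →
      |K2 t y| ≤ s * (s + 2) * r ^ (-s - 2) + s * r ^ (-s - 2) := fun t ht y hy ↦ by
    have hw : 0 < ‖x - y + t • e‖ := hr.trans_le (hfar t ht y hy)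
    have h1 : inner ℝ (x - y + t • e) e ^ 2 ≤ ‖x - y + t • e‖ ^ 2 :=
      sq_le_sq.2 (by simpa using hinner (x - y + t • e))
    have h2 := hpow (-s - 2) (by linarith) t ht y hy
    have h3 : ‖x - y + t • e‖ ^ 2 * ‖x - y + t • e‖ ^ (-s - 4) = ‖x - y + t • e‖ ^ (-s - 2) := by
      rw [← Real.rpow_natCast, ← Real.rpow_add hw]
      congr 1; push_cast; ring
    refine (abs_sub _ _).trans (add_le_add ?_ ?_)
    · rw [abs_of_nonneg (by positivity), mul_assoc]
      gcongr
      refine le_trans ?_ h2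
      rw [← h3]
      gcongr
    · rw [abs_of_nonneg (by positivity)]
      gcongr
  have hd0 : ∀ t, |t| < r → ∀ y, u y ≠ 0 → HasDerivAt (fun τ ↦ K0 τ y) (K1 t y) t :=
    fun t ht y hy ↦ hasDerivAt_norm_add_smul_rpow _
      (norm_pos_iff.1 (hr.trans_le (hfar t ht y hy)))
  have hd1 : ∀ t, |t| < r → ∀ y, u y ≠ 0 → HasDerivAt (fun τ ↦ K1 τ y) (K2 t y) t := by
    intro t ht y hy
    have h1 := hasDerivAt_norm_add_smul_rpow (-s - 2)
      (norm_pos_iff.1 (hr.trans_le (hfar t ht y hy)))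
    have h2 : HasDerivAt (fun τ : ℝ ↦ inner ℝ (x - y + τ • e) e) 1 t := by
      have : HasDerivAt (fun τ : ℝ ↦ inner ℝ (x - y) e + τ) 1 t :=
        (hasDerivAt_id t).const_add _
      simpa [inner_add_left, inner_smul_left, he] using this
    refine ((h2.const_mul (-s)).mul h1).congr_deriv ?_
    simp only [hK2, show -s - 2 - 2 = -s - 4 by ring]
    ring
  have hz0 : ∀ t, |t| < r → ∫ y, u y * K0 t y ∂μ = 0 := fun t ht ↦ by
    simpa only [hK0, sub_add_eq_add_sub] using h _ (hmem t ht)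
  have hderiv0 : ∀ {F : ℝ → ℝ} {F' t : ℝ}, (∀ τ, |τ| < r → F τ = 0) → |t| < r →
      HasDerivAt F F' t → F' = 0 := by
    intro F F' t hF ht hFd
    refine hFd.unique ((hasDerivAt_const t (0 : ℝ)).congr_of_eventuallyEq ?_)
    filter_upwards [(isOpen_lt continuous_abs continuous_const).mem_nhds ht] with τ hτ
    exact hF τ hτ
  have hz1 : ∀ t, |t| < r → ∫ y, u y * K1 t y ∂μ = 0 := fun t ht ↦
    hderiv0 hz0 ht (hasDerivAt_integral_mul_of_bounded_on_support hu hm0 hm1 hb0 hb1 hd0 ht)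
  have h0 : |(0 : ℝ)| < r := by simpa using hr
  have hz2 := hderiv0 hz1 h0
    (hasDerivAt_integral_mul_of_bounded_on_support hu hm1 hm2 hb1 hb2 hd1 h0)
  have hi2 := integrable_mul_of_bounded_on_support hu (hm2 0) (hb2 0 h0)
  simpa only [hK2, zero_smul, add_zero] using And.intro hi2 hz2

/-- Taking the Laplacian of a vanishing potential with exponent `s` shows that the potential with
exponent `s + 2` vanishes too. -/
lemma integral_mul_norm_rpow_eq_zero_add_two [FiniteDimensional ℝ E] [MeasurableSpace E]
    [BorelSpace E] (μ : Measure E)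
    {u : E → ℝ} (hu : Integrable u μ) {S : Set E} (hS : IsOpen S) (huS : ∀ x ∈ S, u x = 0)
    {s : ℝ} (hs : 0 < s) (hsn : s + 2 ≠ Module.finrank ℝ E)
    (h : ∀ x ∈ S, ∫ y, u y * ‖x - y‖ ^ (-s) ∂μ = 0) :
    ∀ x ∈ S, ∫ y, u y * ‖x - y‖ ^ (-(s + 2)) ∂μ = 0 := by
  intro x hx
  set b := stdOrthonormalBasis ℝ E
  obtain ⟨r, hr, hball⟩ := Metric.isOpen_iff.1 hS x hx
  have hfar : ∀ y, u y ≠ 0 → r ≤ ‖x - y‖ := fun y hy ↦ by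
    by_contra hc
    exact hy (huS y (hball (by rw [Metric.mem_ball, dist_comm, dist_eq_norm]; linarith)))
  have hsecond := fun i ↦ integral_mul_second_deriv_norm_rpow_eq_zero μ hu hS huS hs h hx
    (b.norm_eq_one i)
  have hlap : ∀ y, ∑ i, u y * (s * (s + 2) * inner ℝ (x - y) (b i) ^ 2 *
      ‖x - y‖ ^ (-s - 4) - s * ‖x - y‖ ^ (-s - 2)) =
        s * (s + 2 - Module.finrank ℝ E) * (u y * ‖x - y‖ ^ (-(s + 2))) := by
    intro y
    by_cases hy : u y = 0
    · simp [hy]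
    have hw : 0 < ‖x - y‖ := hr.trans_le (hfar y hy)
    have h2 : ∑ i, inner ℝ (x - y) (b i) ^ 2 = ‖x - y‖ ^ 2 := by
      simpa using b.sum_sq_norm_inner_left (x - y)
    have h3 : ‖x - y‖ ^ 2 * ‖x - y‖ ^ (-s - 4) = ‖x - y‖ ^ (-(s + 2)) := by
      rw [← Real.rpow_natCast, ← Real.rpow_add hw]
      congr 1; push_cast; ring
    rw [← Finset.mul_sum, Finset.sum_sub_distrib, ← Finset.sum_mul, ← Finset.mul_sum, h2,
      mul_assoc (s * (s + 2)), h3, Finset.sum_const, Finset.card_univ, Fintype.card_fin,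
      nsmul_eq_mul, show -s - 2 = -(s + 2) by ring]
    ring
  have hzero : ∫ y, s * (s + 2 - Module.finrank ℝ E) * (u y * ‖x - y‖ ^ (-(s + 2))) ∂μ = 0 := by
    simp only [← hlap]
    rw [integral_finsetSum _ fun i _ ↦ (hsecond i).1]
    exact Finset.sum_eq_zero fun i _ ↦ (hsecond i).2
  rw [integral_const_mul] at hzero
  exact (mul_eq_zero.1 hzero).resolve_left (mul_ne_zero hs.ne' (sub_ne_zero.2 hsn))

end UniqueContinuation


/-- Unique continuation for the fractional Laplacian. If a Schwartz
function `u` on `ℝⁿ` vanishes on a nonempty open set `Σ` and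
`∫_{ℝⁿ} u(y) |x − y|^{-(n+2a)} dy = 0` for every `x ∈ Σ`, then `u ≡ 0`. -/
theorem fractional_laplacian_unique_continuation (n : ℕ) (hn : 1 ≤ n) (a : ℝ)
    (ha : a ∈ Ioo (0 : ℝ) 1)
    (u : SchwartzMap (EuclideanSpace ℝ (Fin n)) ℝ)
    (S : Set (EuclideanSpace ℝ (Fin n))) (hSopen : IsOpen S) (hSne : S.Nonempty)
    (hu0 : ∀ x ∈ S, u x = 0)
    (hint : ∀ x ∈ S, (∫ y, u y * ‖x - y‖ ^ (-((n : ℝ) + 2 * a))) = 0) :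
    ∀ x, u x = 0 := by
  obtain ⟨x₀, hx₀⟩ := hSne
  have hui : Integrable (fun y ↦ u y) (volume : Measure (EuclideanSpace ℝ (Fin n))) := u.integrable
  have hs : 0 < (n : ℝ) + 2 * a := by have := ha.1; positivity
  have hpot : ∀ k : ℕ, ∀ x ∈ S, ∫ y, u y * ‖x - y‖ ^ (-((n : ℝ) + 2 * a + 2 * k)) = 0 := by
    intro k
    induction k with
    | zero => simpa using hint
    | succ k ih =>
      have hk : (0 : ℝ) ≤ k := k.cast_nonneg
      have := integral_mul_norm_rpow_eq_zero_add_two volume hui hSopen hu0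
        (s := (n : ℝ) + 2 * a + 2 * k) (by positivity)
        (by rw [finrank_euclideanSpace_fin]; have := ha.1; intro hc; linarith) ih
      simpa only [Nat.cast_add, Nat.cast_one, mul_add, mul_one, add_assoc] using this
  have hzero : (fun y ↦ u y) = 0 := by
    refine eq_zero_of_integral_mul_exp_neg_norm_sq_eq_zero volume u.continuous hui hSopen hx₀
      fun x hx ↦ ?_
    obtain ⟨r, hr, hball⟩ := Metric.isOpen_iff.1 hSopen x hx
    refine integral_mul_exp_neg_norm_sq_eq_zero volume hui hr (fun y hy ↦ ?_) hs
      fun k ↦ hpot k x hx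
    by_contra hc
    exact hy (hu0 y (hball (by rw [Metric.mem_ball, dist_comm, dist_eq_norm]; linarith)))
  exact fun x ↦ congrFun hzero x
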